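/- Under hypotheses (H0)-(H3), for every t > ρ(P) and every a ∈ Γ₊^t such that φ₀(ā^t) = t and a ∉ ∂₀D^t, the normal cone to Ĥ^t at a is V_t(a) = {c₁ ∇φ(a) + c₂ (∇φ₀(ā^t) + κ_a ∇φ(ā^t)) : c₁ ≥ 0, c₂ ≥ 0}, where κ_a = − (∂φ₀/∂β)(ā^t) / (∂φ/∂β)(ā^t), the partial derivatives being taken in the last coordinate. -/

import Mathlib

open scoped Classical BigOperators
open Filter

noncomputable section

namespace RWHalfspace

/-- `ℤ^d` modeled as `ℤ^{d-1} × ℤ`; the Lean parameter `d` is the paper's `d-1`,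
so that the paper's hypothesis `d ≥ 1` is automatic. -/
abbrev Zd (d : ℕ) := (Fin d → ℤ) × ℤ
/-- The state space `E = ℤ^{d-1} × ℕ`. -/
abbrev Ed (d : ℕ) := (Fin d → ℤ) × ℕ
/-- `ℝ^d` modeled as `ℝ^{d-1} × ℝ`. -/
abbrev Rd (d : ℕ) := (Fin d → ℝ) × ℝ

variable {d : ℕ}

/-- The scalar product `a · z` for `a ∈ ℝ^d`, `z ∈ ℤ^d`. -/
def dotZ (a : Rd d) (z : Zd d) : ℝ := (∑ i, a.1 i * (z.1 i : ℝ)) + a.2 * (z.2 : ℝ)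

/-- The scalar product on `ℝ^d`. -/
def dotR (a b : Rd d) : ℝ := (∑ i, a.1 i * b.1 i) + a.2 * b.2

/-- The scalar product `a · z` for `a ∈ ℝ^d`, `z ∈ E = ℤ^{d-1} × ℕ`. -/
def dotE (a : Rd d) (z : Ed d) : ℝ := (∑ i, a.1 i * (z.1 i : ℝ)) + a.2 * (z.2 : ℝ)

/-- The jump generating function `φ(a) = ∑_{z ∈ ℤ^d} μ(z) e^{a·z}`. -/
def phi (μ : Zd d → ℝ) (a : Rd d) : ℝ := ∑' z, μ z * Real.exp (dotZ a z)

/-- The difference `z' - z ∈ ℤ^d` of two points of `E`. -/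
def jump (z z' : Ed d) : Zd d := (z'.1 - z.1, (z'.2 : ℤ) - (z.2 : ℤ))

/-- The transition kernel of the reflected random walk on `E = ℤ^{d-1} × ℕ`. -/
def ker (μ μ₀ : Zd d → ℝ) (z z' : Ed d) : ℝ :=
  if z.2 = 0 then μ₀ (jump z z') else μ (jump z z')

/-- The `n`-step transition kernel `p^(n)`. -/
def kerN (μ μ₀ : Zd d → ℝ) : ℕ → Ed d → Ed d → ℝ
  | 0 => fun z z' => if z = z' then 1 else 0
  | n + 1 => fun z z' => ∑' w, kerN μ μ₀ n z w * ker μ μ₀ w z'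

/-- The `n`-step kernel of the homogeneous random walk on `ℤ^d` with step distribution `μ`. -/
def homN (μ : Zd d → ℝ) : ℕ → Zd d → Zd d → ℝ
  | 0 => fun z z' => if z = z' then 1 else 0
  | n + 1 => fun z z' => ∑' w, homN μ n z w * μ (z' - w)

/-- The step distribution of the last coordinate of the homogeneous random walk. -/
def lastStep (μ : Zd d → ℝ) (k : ℤ) : ℝ := ∑' x : Fin d → ℤ, μ (x, k)

/-- The `n`-step kernel of the last coordinate random walk on `ℤ`. -/
def lastN (μ : Zd d → ℝ) : ℕ → ℤ → ℤ → ℝ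
  | 0 => fun k k' => if k = k' then 1 else 0
  | n + 1 => fun k k' => ∑' j, lastN μ n k j * lastStep μ (k' - j)

/-- The convergence norm `ρ(P) = limsup_n (p^(n)(z,z'))^{1/n}` (independent of `z, z'`
by irreducibility; we take `z = z' = 0`). -/
def rho (μ μ₀ : Zd d → ℝ) : ℝ :=
  limsup (fun n : ℕ => (kerN μ μ₀ n 0 0) ^ ((n : ℝ)⁻¹)) atTop

/-- `μ` is a nonnegative measure on `ℤ^d` with `0 < μ(ℤ^d) ≤ 1`. -/
def IsMeasure (μ : Zd d → ℝ) : Prop := (∀ z, 0 ≤ μ z) ∧ 0 < ∑' z, μ z ∧ ∑' z, μ z ≤ 1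

/-- (H0): `μ(x,y) = 0` for `y < -1` and `μ₀(x,y) = 0` for `y < 0`. -/
def H0 (μ μ₀ : Zd d → ℝ) : Prop :=
  (∀ z : Zd d, z.2 < -1 → μ z = 0) ∧ (∀ z : Zd d, z.2 < 0 → μ₀ z = 0)

/-- (H1): the kernel `P` is irreducible on `E`. -/
def H1 (μ μ₀ : Zd d → ℝ) : Prop := ∀ z z' : Ed d, ∃ n, 0 < kerN μ μ₀ n z z'

/-- (H2): the homogeneous random walk with step distribution `μ` is irreducible on `ℤ^d`. -/
def H2 (μ : Zd d → ℝ) : Prop := ∀ z z' : Zd d, ∃ n, 0 < homN μ n z z'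

/-- (H3) for a single measure: the jump generating function is finite everywhere
(the defining series converges for every `a ∈ ℝ^d`). -/
def H3 (μ : Zd d → ℝ) : Prop := ∀ a : Rd d, Summable fun z => μ z * Real.exp (dotZ a z)

/-- (H4): the last coordinate of the `μ`-random walk is aperiodic
(the gcd of `{n : p^n(0,0) > 0}` equals `1`). -/
def H4 (μ : Zd d → ℝ) : Prop := ∀ m : ℕ, (∀ n : ℕ, 0 < lastN μ n 0 0 → m ∣ n) → m = 1

/-- The sublevel set `D^t = {a : φ(a) ≤ t}`. -/
def Dset (μ : Zd d → ℝ) (t : ℝ) : Set (Rd d) := {a | phi μ a ≤ t}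

/-- `Θ^t = {α ∈ ℝ^{d-1} : inf_β max(φ(α,β), φ₀(α,β)) ≤ t}`. -/
def Theta (μ μ₀ : Zd d → ℝ) (t : ℝ) : Set (Fin d → ℝ) :=
  {α | sInf (Set.range fun β : ℝ => max (phi μ (α, β)) (phi μ₀ (α, β))) ≤ t}

/-- `Ĥ^t = (Θ^t × ℝ) ∩ D^t`. -/
def Hhat (μ μ₀ : Zd d → ℝ) (t : ℝ) : Set (Rd d) :=
  {a | a.1 ∈ Theta μ μ₀ t ∧ phi μ a ≤ t}

/-- Partial derivative of `f : ℝ^d → ℝ` in the last coordinate. -/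
def dBeta (f : Rd d → ℝ) (a : Rd d) : ℝ := fderiv ℝ f a (0, 1)

/-- The (coordinate) gradient of `f : ℝ^d → ℝ`. -/
def gradV (f : Rd d → ℝ) (a : Rd d) : Rd d :=
  (fun i => fderiv ℝ f a (Pi.single i 1, 0), fderiv ℝ f a (0, 1))

/-- `∂₊D^t`: boundary points of `D^t` where the last coordinate of `∇φ` is `≥ 0`. -/
def dPlus (μ : Zd d → ℝ) (t : ℝ) : Set (Rd d) :=
  {a | a ∈ frontier (Dset μ t) ∧ 0 ≤ dBeta (phi μ) a}

/-- `∂₀D^t`: boundary points of `D^t` where the last coordinate of `∇φ` is `0`. -/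
def dZero (μ : Zd d → ℝ) (t : ℝ) : Set (Rd d) :=
  {a | a ∈ frontier (Dset μ t) ∧ dBeta (phi μ) a = 0}

/-- `Γ₊^t = Ĥ^t ∩ ∂₊D^t`. -/
def GammaPlus (μ μ₀ : Zd d → ℝ) (t : ℝ) : Set (Rd d) := Hhat μ μ₀ t ∩ dPlus μ t

/-- The normal cone `V_t(a)` to `Ĥ^t` at `a`. -/
def Vcone (μ μ₀ : Zd d → ℝ) (t : ℝ) (a : Rd d) : Set (Rd d) :=
  {q | ∀ a' ∈ Hhat μ μ₀ t, dotR q (a' - a) ≤ 0}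

/-- `β̄ = min{b : φ(α,b) ≤ t}`. -/
def betaBar (μ : Zd d → ℝ) (t : ℝ) (α : Fin d → ℝ) : ℝ := sInf {b : ℝ | phi μ (α, b) ≤ t}

/-- `ā^t`: the lowest point of `D^t` with the same first `d-1` coordinates as `a`. -/
def abar (μ : Zd d → ℝ) (t : ℝ) (a : Rd d) : Rd d := (a.1, betaBar μ t a.1)

/-- The Green function `G_t(z,z') = ∑_n t^{-n} p^(n)(z,z')`. -/
def green (μ μ₀ : Zd d → ℝ) (t : ℝ) (z z' : Ed d) : ℝ :=
  ∑' n, (t ^ n)⁻¹ * kerN μ μ₀ n z z'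

/-- The `t`-Martin kernel `K_t(z,z') = G_t(z,z')/G_t(z₀,z')` with reference point `z₀`. -/
def martin (μ μ₀ : Zd d → ℝ) (t : ℝ) (z₀ z z' : Ed d) : ℝ :=
  green μ μ₀ t z z' / green μ μ₀ t z₀ z'

/-- Euclidean norm on `ℝ^d = ℝ^{d-1} × ℝ`. -/
def euclNorm (a : Rd d) : ℝ := Real.sqrt ((∑ i, a.1 i ^ 2) + a.2 ^ 2)

/-- The point of `ℝ^d` corresponding to `z ∈ E`. -/
def vecE (z : Ed d) : Rd d := (fun i => (z.1 i : ℝ), (z.2 : ℝ))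

/-- Euclidean distance from a point `v` to a set `S ⊆ ℝ^d`. -/
def distTo (S : Set (Rd d)) (v : Rd d) : ℝ := sInf ((fun q => euclNorm (v - q)) '' S)

/-- The function `h_{a,t}` of the paper. -/
def hFun (μ μ₀ : Zd d → ℝ) (t : ℝ) (a : Rd d) (z : Ed d) : ℝ :=
  if a ∉ dZero μ t ∧ phi μ₀ (abar μ t a) < t then
    Real.exp (dotE a z)
      - ((t - phi μ₀ a) / (t - phi μ₀ (abar μ t a))) * Real.exp (dotE (abar μ t a) z)
  else if a = abar μ t a ∧ a ∈ dZero μ t ∧ phi μ₀ a < t then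
    ((z.2 : ℝ) + dBeta (phi μ₀) a / (t - phi μ₀ a)) * Real.exp (dotE a z)
  else Real.exp (dotE (abar μ t a) z)



/-! ### Analysis of the generating functions -/

/-- The linear functional `a ↦ a · z`. -/
def Lz (z : Zd d) : Rd d →L[ℝ] ℝ :=
  LinearMap.toContinuousLinearMap
    { toFun := fun a => dotZ a z
      map_add' := by
        intro a b
        simp only [dotZ, Prod.fst_add, Prod.snd_add, Pi.add_apply, add_mul, Finset.sum_add_distrib]
        ring
      map_smul' := by
        intro c a
        simp only [dotZ, Prod.smul_fst, Prod.smul_snd, Pi.smul_apply, smul_eq_mul, RingHom.id_apply,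
          mul_add, Finset.mul_sum, mul_assoc] }

lemma Lz_apply (z : Zd d) (a : Rd d) : Lz z a = dotZ a z := rfl

/-- The `ℓ¹` size of `z`. -/
def size (z : Zd d) : ℝ := (∑ i, |(z.1 i : ℝ)|) + |(z.2 : ℝ)|

lemma size_nonneg (z : Zd d) : 0 ≤ size z := by unfold size; positivity

lemma abs_dotZ_le (a : Rd d) (z : Zd d) : |dotZ a z| ≤ ‖a‖ * size z := by
  unfold dotZ size
  calc |(∑ i, a.1 i * (z.1 i : ℝ)) + a.2 * (z.2 : ℝ)|
      ≤ (∑ i, |a.1 i * (z.1 i : ℝ)|) + |a.2 * (z.2 : ℝ)| :=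
        (abs_add_le _ _).trans (by gcongr; exact Finset.abs_sum_le_sum_abs _ _)
    _ ≤ (∑ i, ‖a‖ * |(z.1 i : ℝ)|) + ‖a‖ * |(z.2 : ℝ)| := by
        gcongr with i
        · rw [abs_mul]; gcongr
          exact (norm_le_pi_norm a.1 i).trans (norm_fst_le a)
        · rw [abs_mul]; gcongr
          exact norm_snd_le a
    _ = _ := by rw [← Finset.mul_sum]; ring

lemma norm_Lz_le (z : Zd d) : ‖Lz z‖ ≤ size z :=
  ContinuousLinearMap.opNorm_le_bound _ (size_nonneg z) fun a => by
    rw [Lz_apply, Real.norm_eq_abs, mul_comm]; exact abs_dotZ_le a z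

/-- sign vectors -/
def sgnV (R : ℝ) (σ : (Fin d → Bool) × Bool) : Rd d :=
  (fun i => if σ.1 i then R else -R, if σ.2 then R else -R)

lemma exp_size_le (R : ℝ) (z : Zd d) :
    Real.exp (R * size z) ≤ ∑ σ : (Fin d → Bool) × Bool, Real.exp (dotZ (sgnV R σ) z) := by
  let σ₀ : (Fin d → Bool) × Bool := (fun i => decide (0 ≤ z.1 i), decide (0 ≤ z.2))
  have key : ∀ k : ℤ, (if decide (0 ≤ k) = true then R else -R) * (k : ℝ) = R * |(k : ℝ)| := by
    intro k
    by_cases hk : 0 ≤ k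
    · have : (0 : ℝ) ≤ k := by exact_mod_cast hk
      simp [hk, abs_of_nonneg this]
    · have : (k : ℝ) < 0 := by exact_mod_cast (not_le.mp hk)
      simp [hk, abs_of_neg this]
  have h : R * size z = dotZ (sgnV R σ₀) z := by
    simp only [size, dotZ, sgnV, σ₀, key, mul_add, Finset.mul_sum]
  rw [h]
  exact Finset.single_le_sum (f := fun σ => Real.exp (dotZ (sgnV R σ) z))
    (fun _ _ => (Real.exp_pos _).le) (Finset.mem_univ σ₀)

lemma dotZ_add (a b : Rd d) (z : Zd d) : dotZ (a + b) z = dotZ a z + dotZ b z :=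
  (Lz z).map_add a b

lemma dotZ_sub (a b : Rd d) (z : Zd d) : dotZ (a - b) z = dotZ a z - dotZ b z :=
  (Lz z).map_sub a b

lemma summable_exp_size {μ : Zd d → ℝ} (hμ : ∀ z, 0 ≤ μ z) (h3 : H3 μ) (a : Rd d) (R : ℝ) :
    Summable fun z => μ z * Real.exp (dotZ a z) * Real.exp (R * size z) := by
  have hs : Summable fun z => ∑ σ : (Fin d → Bool) × Bool,
      μ z * Real.exp (dotZ (a + sgnV R σ) z) := summable_sum fun σ _ => h3 _
  refine Summable.of_nonneg_of_le (fun z => ?_) (fun z => ?_) hs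
  · have := hμ z; positivity
  · simp only [dotZ_add, Real.exp_add, ← mul_assoc]
    rw [← Finset.mul_sum]
    exact mul_le_mul_of_nonneg_left (exp_size_le R z) (mul_nonneg (hμ z) (Real.exp_pos _).le)

lemma phi_deriv {μ : Zd d → ℝ} (hμ : ∀ z, 0 ≤ μ z) (h3 : H3 μ) (a : Rd d) :
    DifferentiableAt ℝ (phi μ) a ∧ ∀ w : Rd d,
      HasSum (fun z => μ z * Real.exp (dotZ a z) * dotZ w z) (fderiv ℝ (phi μ) a w) := by
  have hu : Summable fun z => μ z * Real.exp (dotZ a z) * Real.exp (2 * size z) :=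
    summable_exp_size hμ h3 a 2
  have hbd : ∀ (z : Zd d) (x : Rd d), x ∈ Metric.ball a 1 →
      ‖(μ z * Real.exp (dotZ x z)) • Lz z‖ ≤
        μ z * Real.exp (dotZ a z) * Real.exp (2 * size z) := by
    intro z x hx
    rw [norm_smul, Real.norm_of_nonneg (mul_nonneg (hμ z) (Real.exp_pos _).le), mul_assoc, mul_assoc]
    refine mul_le_mul_of_nonneg_left ?_ (hμ z)
    have h1 : dotZ x z ≤ dotZ a z + size z := by
      have := abs_dotZ_le (x - a) z
      rw [dotZ_sub] at this
      have h2 := (abs_le.mp this).2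
      have h3 : ‖x - a‖ ≤ 1 := by
        have := Metric.mem_ball.mp hx; rw [dist_eq_norm] at this; exact this.le
      nlinarith [size_nonneg z]
    have h2 : ‖Lz z‖ ≤ Real.exp (size z) :=
      (norm_Lz_le z).trans (by linarith [Real.add_one_le_exp (size z)])
    calc Real.exp (dotZ x z) * ‖Lz z‖ ≤ Real.exp (dotZ a z + size z) * Real.exp (size z) := by
          gcongr
      _ = _ := by rw [← Real.exp_add, ← Real.exp_add]; ring_nf
  have ha : a ∈ Metric.ball a 1 := Metric.mem_ball_self one_pos
  have hd : HasFDerivAt (phi μ) (∑' z, (μ z * Real.exp (dotZ a z)) • Lz z) a := by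
    refine hasFDerivAt_tsum_of_isPreconnected (f := fun z x => μ z * Real.exp (dotZ x z))
      (f' := fun z x => (μ z * Real.exp (dotZ x z)) • Lz z)
      hu Metric.isOpen_ball (convex_ball a 1).isPreconnected ?_ hbd ha (h3 a) ha
    intro z x _
    have := ((Lz z).hasFDerivAt (x := x)).exp.const_mul (μ z)
    rw [smul_smul] at this
    exact this
  refine ⟨hd.differentiableAt, fun w => ?_⟩
  have hsum : Summable fun z => (μ z * Real.exp (dotZ a z)) • Lz z :=
    Summable.of_norm_bounded hu fun z => hbd z a ha
  rw [hd.fderiv]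
  have := (ContinuousLinearMap.apply ℝ ℝ w).hasSum hsum.hasSum
  simpa [Lz_apply] using this

lemma phi_continuous {μ : Zd d → ℝ} (hμ : ∀ z, 0 ≤ μ z) (h3 : H3 μ) : Continuous (phi μ) :=
  continuous_iff_continuousAt.mpr fun a => (phi_deriv hμ h3 a).1.continuousAt

lemma phi_nonneg {μ : Zd d → ℝ} (hμ : ∀ z, 0 ≤ μ z) (a : Rd d) : 0 ≤ phi μ a :=
  tsum_nonneg fun z => mul_nonneg (hμ z) (Real.exp_pos _).le

/-- Gradient inequality for the convex function `φ`. -/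
lemma phi_grad {μ : Zd d → ℝ} (hμ : ∀ z, 0 ≤ μ z) (h3 : H3 μ) (a b : Rd d) :
    fderiv ℝ (phi μ) a (b - a) ≤ phi μ b - phi μ a := by
  refine hasSum_le (fun z => ?_) ((phi_deriv hμ h3 a).2 (b - a)) ((h3 b).hasSum.sub (h3 a).hasSum)
  have h := Real.add_one_le_exp (dotZ (b - a) z)
  have e : Real.exp (dotZ b z) = Real.exp (dotZ a z) * Real.exp (dotZ (b - a) z) := by
    rw [← Real.exp_add, dotZ_sub]; ring_nf
  rw [e]
  have hp : 0 ≤ μ z * Real.exp (dotZ a z) := mul_nonneg (hμ z) (Real.exp_pos _).le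
  nlinarith

lemma dBeta_phi0_nonneg {μ : Zd d → ℝ} (hμ : ∀ z, 0 ≤ μ z) (h3 : H3 μ)
    (h0 : ∀ z : Zd d, z.2 < 0 → μ z = 0) (a : Rd d) : 0 ≤ dBeta (phi μ) a := by
  refine hasSum_le (fun z => ?_) hasSum_zero ((phi_deriv hμ h3 a).2 (0, 1))
  rcases lt_or_ge z.2 0 with h | h
  · simp [h0 z h]
  · have : (0 : ℝ) ≤ z.2 := by exact_mod_cast h
    have h' : dotZ ((0, 1) : Rd d) z = z.2 := by simp [dotZ]
    rw [h']
    exact mul_nonneg (mul_nonneg (hμ z) (Real.exp_pos _).le) this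

lemma dotR_gradV (f : Rd d → ℝ) (a w : Rd d) : dotR (gradV f a) w = fderiv ℝ f a w := by
  have hw : w = (∑ i, w.1 i • ((Pi.single i 1, 0) : Rd d)) + w.2 • ((0, 1) : Rd d) := by
    apply Prod.ext
    · funext j
      simp [Prod.fst_sum, Finset.sum_apply, Pi.single_apply]
    · simp [Prod.snd_sum]
  conv_rhs => rw [hw]
  simp only [map_add, map_sum, map_smul, smul_eq_mul, dotR, gradV]
  congr 1
  · exact Finset.sum_congr rfl fun i _ => mul_comm _ _
  · ring

lemma dotR_add_left (p q w : Rd d) : dotR (p + q) w = dotR p w + dotR q w := by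
  simp only [dotR, Prod.fst_add, Prod.snd_add, Pi.add_apply, add_mul, Finset.sum_add_distrib]
  ring

lemma dotR_smul_left (c : ℝ) (q w : Rd d) : dotR (c • q) w = c * dotR q w := by
  simp only [dotR, Prod.smul_fst, Prod.smul_snd, Pi.smul_apply, smul_eq_mul, mul_add,
    Finset.mul_sum, mul_assoc]

lemma dotR_comm (p q : Rd d) : dotR p q = dotR q p := by
  simp only [dotR, mul_comm]

lemma dotR_add_right (p q w : Rd d) : dotR w (p + q) = dotR w p + dotR w q := by
  rw [dotR_comm, dotR_add_left, dotR_comm p, dotR_comm q]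

lemma dotR_smul_right (c : ℝ) (q w : Rd d) : dotR w (c • q) = c * dotR w q := by
  rw [dotR_comm, dotR_smul_left, dotR_comm]

/-- Farkas' lemma for a single vector. -/
lemma farkas_one (v q : Fin d → ℝ) (h : ∀ u : Fin d → ℝ, v ⬝ᵥ u ≤ 0 → q ⬝ᵥ u ≤ 0) :
    ∃ c : ℝ, 0 ≤ c ∧ q = c • v := by
  by_cases hv : v = 0
  · refine ⟨0, le_rfl, ?_⟩
    have := h q (by simp [hv])
    have h0 : q ⬝ᵥ q = 0 := le_antisymm this (Finset.sum_nonneg fun i _ => mul_self_nonneg _)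
    rw [dotProduct_self_eq_zero] at h0
    simp [h0]
  · have hvv : 0 < v ⬝ᵥ v := lt_of_le_of_ne (Finset.sum_nonneg fun i _ => mul_self_nonneg _)
      (fun e => hv (dotProduct_self_eq_zero.mp e.symm))
    refine ⟨(q ⬝ᵥ v) / (v ⬝ᵥ v), ?_, ?_⟩
    · refine div_nonneg ?_ hvv.le
      have := h (-v) (by simp [hvv.le])
      simpa using this
    · set c := (q ⬝ᵥ v) / (v ⬝ᵥ v) with hc
      have hcv : c * (v ⬝ᵥ v) = q ⬝ᵥ v := by rw [hc]; field_simp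
      have h1 : v ⬝ᵥ (q - c • v) = 0 := by
        rw [dotProduct_sub, dotProduct_smul, smul_eq_mul, hcv, dotProduct_comm v q, sub_self]
      have h2 := h _ h1.le
      have h3 : (q - c • v) ⬝ᵥ (q - c • v) = q ⬝ᵥ (q - c • v) := by
        rw [sub_dotProduct, smul_dotProduct, h1]; simp
      have h0 : (q - c • v) ⬝ᵥ (q - c • v) = 0 :=
        le_antisymm (h3 ▸ h2) (Finset.sum_nonneg fun i _ => mul_self_nonneg _)
      exact sub_eq_zero.mp (dotProduct_self_eq_zero.mp h0)

/-- A small step in a strict descent direction decreases the function. -/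
lemma descent {f : Rd d → ℝ} {a w : Rd d} (hf : DifferentiableAt ℝ f a)
    (hw : fderiv ℝ f a w < 0) : ∀ᶠ ε : ℝ in nhdsWithin 0 (Set.Ioi 0), f (a + ε • w) < f a := by
  have h1 : HasDerivAt (fun ε : ℝ => f (a + ε • w)) (fderiv ℝ f a w) 0 := by
    have hl : HasDerivAt (fun ε : ℝ => a + ε • w) w 0 := by
      simpa using ((hasDerivAt_id (0 : ℝ)).smul_const w).const_add a
    have hf' : HasFDerivAt f (fderiv ℝ f a) (a + (0 : ℝ) • w) := by
      simpa using hf.hasFDerivAt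
    exact hf'.comp_hasDerivAt 0 hl
  have h2 := (hasDerivAt_iff_tendsto_slope.mp h1).eventually (gt_mem_nhds hw)
  have h3 : ∀ᶠ ε : ℝ in nhdsWithin 0 (Set.Ioi 0),
      slope (fun ε : ℝ => f (a + ε • w)) 0 ε < 0 :=
    h2.filter_mono (nhdsWithin_mono _ fun x hx => ne_of_gt hx)
  filter_upwards [h3, self_mem_nhdsWithin] with ε h4 (h5 : 0 < ε)
  rw [slope_def_field] at h4
  simp only [sub_zero, zero_smul, add_zero] at h4
  rw [div_lt_iff₀ h5] at h4
  linarith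

lemma betaBar_spec {μ : Zd d → ℝ} (hμ : ∀ z, 0 ≤ μ z) (h3 : H3 μ)
    (hdown : ∃ x, 0 < μ (x, -1)) (t : ℝ) (α : Fin d → ℝ) (b : ℝ) (hb : phi μ (α, b) ≤ t) :
    phi μ (α, betaBar μ t α) = t ∧ betaBar μ t α ≤ b := by
  obtain ⟨x, hx⟩ := hdown
  have hcont : Continuous fun b : ℝ => phi μ (α, b) :=
    (phi_continuous hμ h3).comp (by fun_prop)
  set S : Set ℝ := {b : ℝ | phi μ (α, b) ≤ t} with hS
  have hne : S.Nonempty := ⟨b, hb⟩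
  have hcl : IsClosed S := isClosed_le hcont continuous_const
  have hbdd : BddBelow S := by
    set K := μ (x, -1) * Real.exp (∑ i, α i * (x i : ℝ)) with hK
    have hKpos : 0 < K := by positivity
    refine ⟨-(t / K), fun c (hc : phi μ (α, c) ≤ t) => ?_⟩
    have h1 : μ (x, -1) * Real.exp (dotZ (α, c) (x, -1)) ≤ phi μ (α, c) :=
      (h3 (α, c)).le_tsum (x, -1) fun z _ => mul_nonneg (hμ z) (Real.exp_pos _).le
    have h2 : μ (x, -1) * Real.exp (dotZ (α, c) (x, -1)) = K * Real.exp (-c) := by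
      rw [hK, mul_assoc, ← Real.exp_add]; simp [dotZ]
    have h4 : K * (-c) ≤ t := by
      have := Real.add_one_le_exp (-c)
      nlinarith
    have h5 : -c ≤ t / K := by rw [le_div_iff₀ hKpos]; linarith
    linarith
  have hmem : betaBar μ t α ∈ S := hcl.csInf_mem hne hbdd
  refine ⟨le_antisymm hmem ?_, csInf_le hbdd hb⟩
  by_contra hlt
  push Not at hlt
  have hev := (hcont.continuousAt (x := betaBar μ t α)).eventually (gt_mem_nhds hlt)
  obtain ⟨ε, hε, hball⟩ := Metric.eventually_nhds_iff.mp hev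
  have h6 := hball (y := betaBar μ t α - ε / 2) (by
    rw [Real.dist_eq]; simp only [sub_sub_cancel_left, abs_neg]; rw [abs_of_pos (by linarith)]; linarith)
  have h7 : betaBar μ t α ≤ betaBar μ t α - ε / 2 := csInf_le hbdd h6.le
  linarith

lemma cone_of_slater (μ μ₀ : Zd d → ℝ) (hμ : ∀ z, 0 ≤ μ z) (hμ₀ : ∀ z, 0 ≤ μ₀ z)
    (h0 : ∀ z : Zd d, z.2 < 0 → μ₀ z = 0) (h3 : H3 μ) (h3' : H3 μ₀)
    (hdown : ∃ x, 0 < μ (x, -1))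
    (t : ℝ) (s : Rd d) (hs : phi μ s < t) (hs₀ : phi μ₀ s < t)
    (a : Rd d) (ha : a ∈ GammaPlus μ μ₀ t)
    (hcase : phi μ₀ (abar μ t a) = t ∧ a ∉ dZero μ t) :
    Vcone μ μ₀ t a =
      {v : Rd d | ∃ c₁ c₂ : ℝ, 0 ≤ c₁ ∧ 0 ≤ c₂ ∧
        v = c₁ • gradV (phi μ) a +
            c₂ • (gradV (phi μ₀) (abar μ t a) +
              (-(dBeta (phi μ₀) (abar μ t a) / dBeta (phi μ) (abar μ t a))) •
                gradV (phi μ) (abar μ t a))} := by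
  obtain ⟨⟨hΘ, hφa⟩, hfr, hge⟩ := ha
  obtain ⟨hφ₀, hnz⟩ := hcase
  have hcont := phi_continuous hμ h3
  have hφat : phi μ a = t := by
    refine le_antisymm hφa (not_lt.mp fun hlt => ?_)
    have : a ∈ interior (Dset μ t) := by
      rw [mem_interior_iff_mem_nhds]
      filter_upwards [hcont.continuousAt.eventually (gt_mem_nhds hlt)] with b hb using le_of_lt hb
    exact hfr.2 this
  have hpos : 0 < dBeta (phi μ) a := lt_of_le_of_ne hge fun e => hnz ⟨hfr, e.symm⟩
  obtain ⟨hφb, _⟩ := betaBar_spec hμ h3 hdown t a.1 a.2 hφa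
  set A := abar μ t a with hA
  have hA1 : A.1 = a.1 := rfl
  have hφA : phi μ A = t := hφb
  -- the derivative at the lower point is negative
  have hneg : dBeta (phi μ) A < 0 := by
    have hdir : fderiv ℝ (phi μ) a (0, -1) < 0 := by
      have : ((0, -1) : Rd d) = -(0, 1) := by simp
      rw [this, map_neg]; simpa [dBeta] using hpos
    obtain ⟨ε, hε, hε0⟩ := ((descent (phi_deriv hμ h3 a).1 hdir).and self_mem_nhdsWithin).exists
    have hε0 : 0 < ε := hε0
    set b := a + ε • ((0, -1) : Rd d) with hb
    have hb1 : b.1 = a.1 := by simp [hb]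
    have hbt : phi μ b < t := hφat ▸ hε
    have hbb : A.2 ≤ b.2 := (betaBar_spec hμ h3 hdown t a.1 b.2 (by rw [← hb1]; exact hbt.le)).2
    have hg := phi_grad hμ h3 A b
    have hd : b - A = (b.2 - A.2) • ((0, 1) : Rd d) := by
      apply Prod.ext
      · simp [hb1, hA1]
      · simp
    rw [hd, map_smul, smul_eq_mul, hφA] at hg
    change (b.2 - A.2) * dBeta (phi μ) A ≤ _ at hg
    by_contra hcon
    push Not at hcon
    have := mul_nonneg (sub_nonneg.mpr hbb) hcon
    linarith
  have hκ0 := dBeta_phi0_nonneg hμ₀ h3' h0 A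
  set κ := -(dBeta (phi μ₀) A / dBeta (phi μ) A) with hκ
  have hκn : 0 ≤ κ := by
    rw [hκ, ← div_neg]; exact div_nonneg hκ0 (by linarith)
  set n := gradV (phi μ) a with hn
  set v := gradV (phi μ₀) A + κ • gradV (phi μ) A with hv
  have hn2 : n.2 = dBeta (phi μ) a := rfl
  have hv2 : v.2 = 0 := by
    change dBeta (phi μ₀) A + κ * dBeta (phi μ) A = 0
    rw [hκ, neg_mul, div_mul_cancel₀ _ hneg.ne, add_neg_cancel]
  have hnw : ∀ w, dotR n w = fderiv ℝ (phi μ) a w := dotR_gradV _ _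
  have hvw : ∀ w, dotR v w = fderiv ℝ (phi μ₀) A w + κ * fderiv ℝ (phi μ) A w := fun w => by
    rw [hv, dotR_add_left, dotR_smul_left, dotR_gradV, dotR_gradV]
  have hv1 : ∀ w w' : Rd d, w.1 = w'.1 → dotR v w = dotR v w' := fun w w' e => by
    simp only [dotR, hv2, e, zero_mul]
  -- inequality for v
  have hvle : ∀ b : Rd d, dotR v (b - a) ≤ (phi μ₀ b - t) + κ * (phi μ b - t) := fun b => by
    rw [hv1 (b - a) (b - A) (by simp [hA1]), hvw]
    have g1 := phi_grad hμ h3 A b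
    have g2 := phi_grad hμ₀ h3' A b
    rw [hφA] at g1
    rw [hφ₀] at g2
    have := mul_le_mul_of_nonneg_left g1 hκn
    linarith
  have hnle : ∀ b : Rd d, dotR n (b - a) ≤ phi μ b - t := fun b => by
    rw [hnw, ← hφat]; exact phi_grad hμ h3 a b
  apply Set.Subset.antisymm
  · intro q hq
    -- strict directions
    have hstrict : ∀ w : Rd d, dotR n w < 0 → dotR v w < 0 → dotR q w ≤ 0 := by
      intro w hw1 hw2
      set p := fderiv ℝ (phi μ) A (w.1, 0) with hp
      set B := dBeta (phi μ) A with hB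
      set B₀ := dBeta (phi μ₀) A with hB₀
      have hfd : ∀ (f : Rd d → ℝ) (η : ℝ), fderiv ℝ f A (w.1, η)
          = fderiv ℝ f A (w.1, 0) + η * dBeta f A := fun f η => by
        have : ((w.1, η) : Rd d) = (w.1, 0) + η • (0, 1) := by
          apply Prod.ext <;> simp
        rw [this, map_add, map_smul]; rfl
      obtain ⟨δ, hδ, hδ2⟩ : ∃ δ : ℝ, 0 < δ ∧ δ * B₀ < -dotR v w := by
        refine ⟨-dotR v w / (B₀ + 1), div_pos (by linarith) (by linarith), ?_⟩
        rw [div_mul_eq_mul_div, div_lt_iff₀ (by linarith)]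
        nlinarith
      set η := -p / B + δ with hη
      have e1 : fderiv ℝ (phi μ) A (w.1, η) = δ * B := by
        rw [hfd, hη, add_mul, div_mul_cancel₀ _ hneg.ne]; ring
      have e2 : fderiv ℝ (phi μ₀) A (w.1, η) < 0 := by
        have h5 := hvw (w.1, -p / B)
        rw [hv1 (w.1, -p / B) w rfl, hfd (phi μ), div_mul_cancel₀ _ hneg.ne, ← hp, add_neg_cancel,
          mul_zero, add_zero, hfd] at h5
        rw [hfd, hη]
        linarith
      have d1 := descent (phi_deriv hμ h3 a).1 (hnw w ▸ hw1)
      have d2 := descent (w := (w.1, η)) (phi_deriv hμ h3 A).1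
        (by rw [e1]; exact mul_neg_of_pos_of_neg hδ hneg)
      have d3 := descent (phi_deriv hμ₀ h3' A).1 e2
      obtain ⟨ε, ⟨⟨k1, k2⟩, k3⟩, hε⟩ := (((d1.and d2).and d3).and self_mem_nhdsWithin).exists
      have hε : 0 < ε := hε
      have hmem : a + ε • w ∈ Hhat μ μ₀ t := by
        refine ⟨?_, by rw [← hφat]; exact k1.le⟩
        have hle : max (phi μ (A + ε • (w.1, η))) (phi μ₀ (A + ε • (w.1, η))) ≤ t :=
          max_le (by rw [← hφA]; exact k2.le) (by rw [← hφ₀]; exact k3.le)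
        have hbb : BddBelow (Set.range fun β : ℝ =>
            max (phi μ ((a + ε • w).1, β)) (phi μ₀ ((a + ε • w).1, β))) := by
          refine ⟨0, ?_⟩
          rintro _ ⟨β, rfl⟩
          exact le_max_of_le_left (phi_nonneg hμ _)
        exact le_trans (csInf_le hbb ⟨A.2 + ε * η, rfl⟩) hle
      have := hq _ hmem
      rw [add_sub_cancel_left, dotR_smul_right] at this
      exact nonpos_of_mul_nonpos_right this hε
    have hw0n : dotR n (s - a) < 0 := (hnle s).trans_lt (by linarith)
    have hw0v : dotR v (s - a) < 0 := (hvle s).trans_lt (by nlinarith)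
    have hweak : ∀ w : Rd d, dotR n w ≤ 0 → dotR v w ≤ 0 → dotR q w ≤ 0 := by
      intro w hw1 hw2
      by_contra hcon
      push Not at hcon
      set C := dotR q (s - a) with hC
      have hst : ∀ δ : ℝ, 0 < δ → dotR q w + δ * C ≤ 0 := by
        intro δ hδ
        have := hstrict (w + δ • (s - a))
          (by rw [dotR_add_right, dotR_smul_right]; nlinarith)
          (by rw [dotR_add_right, dotR_smul_right]; nlinarith)
        rwa [dotR_add_right, dotR_smul_right] at this
      have h6 := hst (dotR q w / (2 * (|C| + 1))) (by positivity)
      have h7 : dotR q w / (2 * (|C| + 1)) * C ≥ -(dotR q w / 2) := by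
        rw [ge_iff_le, div_mul_eq_mul_div, le_div_iff₀ (by positivity)]
        nlinarith [neg_abs_le C, abs_nonneg C]
      linarith
    -- first coefficient
    have hc1 : 0 ≤ q.2 := by
      have := hweak (0, -1) (by simp [dotR, hn2]; exact hpos.le) (by simp [dotR, hv2])
      simpa [dotR] using this
    set c₁ := q.2 / n.2 with hc₁
    have hn2pos : 0 < n.2 := hpos
    have hc1n : c₁ * n.2 = q.2 := by rw [hc₁]; field_simp
    obtain ⟨c₂, hc₂, he⟩ := farkas_one v.1 (q.1 - c₁ • n.1) (by
      intro u hu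
      have h8 := hweak (u, -(n.1 ⬝ᵥ u) / n.2)
        (by
          change n.1 ⬝ᵥ u + n.2 * (-(n.1 ⬝ᵥ u) / n.2) ≤ 0
          rw [mul_div_cancel₀ _ hn2pos.ne']; simp)
        (by
          change v.1 ⬝ᵥ u + v.2 * _ ≤ 0
          rw [hv2]; simpa using hu)
      change q.1 ⬝ᵥ u + q.2 * (-(n.1 ⬝ᵥ u) / n.2) ≤ 0 at h8
      rw [sub_dotProduct, smul_dotProduct, smul_eq_mul, hc₁]
      have : q.2 * (-(n.1 ⬝ᵥ u) / n.2) = - (q.2 / n.2 * n.1 ⬝ᵥ u) := by ring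
      linarith)
    refine ⟨c₁, c₂, div_nonneg hc1 hn2pos.le, hc₂, ?_⟩
    apply Prod.ext
    · change q.1 = c₁ • n.1 + c₂ • v.1
      rw [← he]; abel
    · change q.2 = c₁ * n.2 + c₂ * v.2
      rw [hv2, hc1n]; ring
  · rintro _ ⟨c₁, c₂, hc₁, hc₂, rfl⟩ b ⟨hbΘ, hbφ⟩
    rw [dotR_add_left, dotR_smul_left, dotR_smul_left]
    have i1 : dotR n (b - a) ≤ 0 := (hnle b).trans (by linarith)
    have i2 : dotR v (b - a) ≤ 0 := by
      refine le_of_forall_pos_le_add fun ε hε => ?_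
      have hε' : 0 < ε / (1 + κ) := by positivity
      obtain ⟨_, ⟨β, rfl⟩, hβ⟩ := exists_lt_of_csInf_lt (Set.range_nonempty _)
        (lt_of_le_of_lt (show sInf _ ≤ t from hbΘ) (show t < t + ε / (1 + κ) by linarith))
      have j := hvle (b.1, β)
      rw [hv1 ((b.1, β) - a) (b - a) rfl] at j
      have j1 := (le_max_left _ _).trans_lt hβ
      have j2 := (le_max_right _ _).trans_lt hβ
      have j3 : κ * (phi μ (b.1, β) - t) ≤ κ * (ε / (1 + κ)) :=
        mul_le_mul_of_nonneg_left (by linarith) hκn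
      have j4 : ε / (1 + κ) + κ * (ε / (1 + κ)) = ε := by field_simp
      linarith
    have := mul_nonneg hc₁ (neg_nonneg.mpr i1)
    have := mul_nonneg hc₂ (neg_nonneg.mpr i2)
    linarith

/-! ### Invariant means -/

/-- Bounded real functions. -/
def Bd {ι : Type*} (h : ι → ℝ) : Prop := ∃ C, ∀ w, |h w| ≤ C

lemma Bd.add {ι : Type*} {h g : ι → ℝ} (hh : Bd h) (hg : Bd g) : Bd (fun w => h w + g w) := by
  obtain ⟨C, hC⟩ := hh
  obtain ⟨D, hD⟩ := hg
  exact ⟨C + D, fun w => (abs_add_le _ _).trans (add_le_add (hC w) (hD w))⟩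

lemma Bd.smul {ι : Type*} {h : ι → ℝ} (c : ℝ) (hh : Bd h) : Bd (fun w => c * h w) := by
  obtain ⟨C, hC⟩ := hh
  exact ⟨|c| * C, fun w => by rw [abs_mul]; exact mul_le_mul_of_nonneg_left (hC w) (abs_nonneg _)⟩

lemma Bd.comp {ι κ : Type*} {h : ι → ℝ} (hh : Bd h) (e : κ → ι) : Bd (fun w => h (e w)) := by
  obtain ⟨C, hC⟩ := hh
  exact ⟨C, fun w => hC _⟩

/-- A translation invariant mean on bounded functions. -/
structure IsMean {G : Type*} [AddCommGroup G] (M : (G → ℝ) → ℝ) : Prop where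
  add : ∀ h g, Bd h → Bd g → M (fun w => h w + g w) = M h + M g
  smul : ∀ (c : ℝ) h, Bd h → M (fun w => c * h w) = c * M h
  le : ∀ h C, Bd h → (∀ w, h w ≤ C) → M h ≤ C
  inv : ∀ v h, Bd h → M (fun w => h (w + v)) = M h

lemma IsMean.abs_le {G : Type*} [AddCommGroup G] {M : (G → ℝ) → ℝ} (hM : IsMean M) {h : G → ℝ}
    {C : ℝ} (hC : ∀ w, |h w| ≤ C) : |M h| ≤ C := by
  have hb : Bd h := ⟨C, hC⟩
  rw [_root_.abs_le]
  constructor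
  · have := hM.le (fun w => (-1) * h w) C (hb.smul _) fun w => by
      have := (_root_.abs_le.mp (hC w)).1
      linarith
    rw [hM.smul _ _ hb] at this
    linarith
  · exact hM.le h C hb fun w => (_root_.abs_le.mp (hC w)).2

lemma IsMean.sub {G : Type*} [AddCommGroup G] {M : (G → ℝ) → ℝ} (hM : IsMean M) {h g : G → ℝ}
    (hh : Bd h) (hg : Bd g) : M (fun w => h w - g w) = M h - M g := by
  have := hM.add h (fun w => (-1) * g w) hh (hg.smul _)
  rw [hM.smul _ _ hg] at this
  have e : (fun w => h w - g w) = fun w => h w + (-1) * g w := by funext w; ring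
  rw [e, this]; ring

lemma IsMean.sum {G : Type*} [AddCommGroup G] {M : (G → ℝ) → ℝ} (hM : IsMean M) {ι : Type*}
    (F : Finset ι) (p : ι → ℝ) (h : ι → G → ℝ) (hh : ∀ i, Bd (h i)) :
    Bd (fun w => ∑ i ∈ F, p i * h i w) ∧ M (fun w => ∑ i ∈ F, p i * h i w) = ∑ i ∈ F, p i * M (h i) := by
  induction F using Finset.induction_on with
  | empty =>
    have hb : Bd (fun _ : G => (0 : ℝ)) := ⟨0, by simp⟩
    refine ⟨by simpa using hb, ?_⟩
    have := hM.smul 0 _ hb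
    simpa using this
  | insert i F hi ih =>
    simp only [Finset.sum_insert hi]
    refine ⟨((hh i).smul _).add ih.1, ?_⟩
    rw [hM.add _ _ ((hh i).smul _) ih.1, ih.2, hM.smul _ _ (hh i)]

lemma exists_mean_int : ∃ M : (ℤ → ℝ) → ℝ, IsMean M := by
  let U : Ultrafilter ℕ := hyperfilter ℕ
  let avg : (ℤ → ℝ) → ℕ → ℝ := fun h N => (∑ k ∈ Finset.range N, h k) / N
  have habs : ∀ (h : ℤ → ℝ) (C : ℝ), (∀ w, h w ≤ C) → ∀ N : ℕ, 0 < N → avg h N ≤ C := by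
    intro h C hC N hN
    have hN' : (0 : ℝ) < N := by exact_mod_cast hN
    simp only [avg]
    rw [div_le_iff₀ hN']
    calc ∑ k ∈ Finset.range N, h k ≤ ∑ k ∈ Finset.range N, C := Finset.sum_le_sum fun k _ => hC _
      _ = C * N := by simp [mul_comm]
  have hUtop : (U : Filter ℕ) ≤ atTop := Nat.hyperfilter_le_atTop
  have hev : ∀ᶠ N in (U : Filter ℕ), 0 < N := hUtop (eventually_gt_atTop 0)
  have hex : ∀ h, Bd h → ∃ L, Tendsto (avg h) U (nhds L) := by
    rintro h ⟨C, hC⟩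
    have hmem : ∀ᶠ N in (U : Filter ℕ), avg h N ∈ Set.Icc (-C) C := by
      filter_upwards [hev] with N hN
      refine ⟨?_, habs h C (fun w => (abs_le.mp (hC w)).2) N hN⟩
      have := habs (fun w => -h w) C (fun w => by linarith [(abs_le.mp (hC w)).1]) N hN
      simp only [avg, Finset.sum_neg_distrib, neg_div] at this
      simp only [avg]; linarith
    have := (isCompact_Icc (a := -C) (b := C)).ultrafilter_le_nhds (U.map (avg h))
      (by rw [le_principal_iff]; exact hmem)
    obtain ⟨L, _, hL⟩ := this
    exact ⟨L, hL⟩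
  let M : (ℤ → ℝ) → ℝ := fun h => if H : Bd h then (hex h H).choose else 0
  have hMt : ∀ h, Bd h → Tendsto (avg h) U (nhds (M h)) := fun h H => by
    simp only [M, dif_pos H]; exact (hex h H).choose_spec
  have huniq : ∀ h L, Bd h → Tendsto (avg h) U (nhds L) → M h = L := fun h L H hL =>
    tendsto_nhds_unique (hMt h H) hL
  have hinv1 : ∀ h, Bd h → M (fun w => h (w + 1)) = M h := by
    intro h H
    refine huniq _ _ (H.comp _) ?_
    obtain ⟨C, hC⟩ := H
    have e : avg (fun w => h (w + 1)) = fun N => avg h N + (h N - h 0) / N := by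
      funext N
      simp only [avg]
      have h1 := Finset.sum_range_succ (fun k : ℕ => h k) N
      have h2 := Finset.sum_range_succ' (fun k : ℕ => h k) N
      push_cast at h1 h2
      rw [← add_div]; congr 1; linarith
    rw [e]
    have hz : Tendsto (fun N : ℕ => (h N - h 0) / (N : ℝ)) U (nhds 0) := by
      refine Tendsto.mono_left ?_ hUtop
      refine squeeze_zero_norm (a := fun N : ℕ => (2 * C) / (N : ℝ)) (fun N => ?_)
        (tendsto_const_div_atTop_nhds_zero_nat _)
      rw [norm_div, Real.norm_eq_abs, Real.norm_natCast]
      gcongr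
      have := abs_sub (h N) (h 0)
      linarith [hC N, hC 0]
    simpa using (hMt h ⟨C, hC⟩).add hz
  refine ⟨M, ⟨?_, ?_, ?_, ?_⟩⟩
  · intro h g hh hg
    refine huniq _ _ (hh.add hg) ?_
    refine ((hMt h hh).add (hMt g hg)).congr fun N => ?_
    simp only [avg, Finset.sum_add_distrib, add_div]
  · intro c h hh
    refine huniq _ _ (hh.smul c) ?_
    refine ((hMt h hh).const_mul c).congr fun N => ?_
    simp only [avg, ← Finset.mul_sum, mul_div_assoc]
  · intro h C hh hC
    refine le_of_tendsto (hMt h hh) ?_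
    filter_upwards [hev] with N hN using habs h C hC N hN
  · intro v h hh
    induction v using Int.induction_on with
    | zero => simp
    | succ i ih =>
      rw [← ih, ← hinv1 _ (hh.comp fun w => w + (i : ℤ))]
      congr 1; funext w; congr 1; ring
    | pred i ih =>
      rw [← ih, ← hinv1 _ (hh.comp fun w => w + (-(i : ℤ) - 1))]
      congr 1; funext w; congr 1; ring

lemma exists_mean (d : ℕ) : ∃ M : ((Fin d → ℤ) → ℝ) → ℝ, IsMean M := by
  induction d with
  | zero =>
    refine ⟨fun h => h 0, ⟨fun _ _ _ _ => rfl, fun _ _ _ => rfl, fun h C _ hC => hC _, ?_⟩⟩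
    intro v h _
    exact congrArg h (Subsingleton.elim _ _)
  | succ d ih =>
    obtain ⟨M, hM⟩ := ih
    obtain ⟨m, hm⟩ := exists_mean_int
    let T : ((Fin (d + 1) → ℤ) → ℝ) → ℤ → ℝ := fun h k => M fun w => h (Fin.cons k w)
    have hT : ∀ h, Bd h → Bd (T h) := by
      rintro h ⟨C, hC⟩
      exact ⟨C, fun k => hM.abs_le fun w => hC _⟩
    have hc : ∀ h : (Fin (d + 1) → ℤ) → ℝ, Bd h → ∀ k : ℤ,
        Bd fun w : Fin d → ℤ => h (Fin.cons k w) := fun h H k =>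
      H.comp (fun w : Fin d → ℤ => (Fin.cons k w : Fin (d + 1) → ℤ))
    refine ⟨fun h => m (T h), ⟨?_, ?_, ?_, ?_⟩⟩
    · intro h g hh hg
      rw [← hm.add _ _ (hT h hh) (hT g hg)]
      congr 1; funext k
      exact hM.add _ _ (hc h hh k) (hc g hg k)
    · intro c h hh
      rw [← hm.smul _ _ (hT h hh)]
      congr 1; funext k
      exact hM.smul _ _ (hc h hh k)
    · intro h C hh hC
      exact hm.le _ _ (hT h hh) fun k => hM.le _ _ (hc h hh k) fun w => hC _
    · intro v h hh
      rw [← hm.inv (v 0) _ (hT h hh)]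
      congr 1; funext k
      change M _ = M _
      rw [← hM.inv (fun i => v i.succ) _ (hc h hh (k + v 0))]
      congr 1; funext w; beta_reduce; congr 1; funext i
      refine Fin.cases ?_ (fun j => ?_) i <;> simp

/-! ### Kernels in `ℝ≥0∞` -/

/-- One-step kernel in `ℝ≥0∞`. -/
def kE (μ μ₀ : Zd d → ℝ) (z z' : Ed d) : ENNReal := ENNReal.ofReal (ker μ μ₀ z z')

/-- `n`-step kernel in `ℝ≥0∞`. -/
def KN (μ μ₀ : Zd d → ℝ) : ℕ → Ed d → Ed d → ENNReal
  | 0 => fun z z' => if z = z' then 1 else 0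
  | n + 1 => fun z z' => ∑' w, KN μ μ₀ n z w * kE μ μ₀ w z'

lemma jump_inj (z : Ed d) : Function.Injective (jump z) := by
  intro u v h
  simp only [jump, Prod.mk.injEq, sub_left_inj, Nat.cast_inj] at h
  exact Prod.ext h.1 h.2

lemma tsum_ofReal_le_one {μ : Zd d → ℝ} (hμ : IsMeasure μ) (z : Ed d) :
    ∑' z', ENNReal.ofReal (μ (jump z z')) ≤ 1 := by
  have hsum : Summable μ := by
    by_contra h
    have := hμ.2.1
    rw [tsum_eq_zero_of_not_summable h] at this
    exact lt_irrefl _ this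
  calc ∑' z', ENNReal.ofReal (μ (jump z z')) ≤ ∑' u, ENNReal.ofReal (μ u) :=
        ENNReal.tsum_comp_le_tsum_of_injective (jump_inj z) (fun u => ENNReal.ofReal (μ u))
    _ = ENNReal.ofReal (∑' u, μ u) := (ENNReal.ofReal_tsum_of_nonneg hμ.1 hsum).symm
    _ ≤ 1 := by
        rw [← ENNReal.ofReal_one]
        exact ENNReal.ofReal_le_ofReal hμ.2.2

lemma kE_row {μ μ₀ : Zd d → ℝ} (hμ : IsMeasure μ) (hμ₀ : IsMeasure μ₀) (z : Ed d) :
    ∑' z', kE μ μ₀ z z' ≤ 1 := by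
  unfold kE ker
  by_cases h : z.2 = 0
  · simp only [h, if_true]; exact tsum_ofReal_le_one hμ₀ z
  · simp only [h, if_false]; exact tsum_ofReal_le_one hμ z

lemma KN_row {μ μ₀ : Zd d → ℝ} (hμ : IsMeasure μ) (hμ₀ : IsMeasure μ₀) (n : ℕ) (z : Ed d) :
    ∑' z', KN μ μ₀ n z z' ≤ 1 := by
  induction n with
  | zero => simp [KN]
  | succ n ih =>
    simp only [KN]
    rw [ENNReal.tsum_comm]
    calc ∑' w, ∑' z', KN μ μ₀ n z w * kE μ μ₀ w z'
        = ∑' w, KN μ μ₀ n z w * ∑' z', kE μ μ₀ w z' := by simp only [ENNReal.tsum_mul_left]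
      _ ≤ ∑' w, KN μ μ₀ n z w * 1 := by
          gcongr with w; exact kE_row hμ hμ₀ w
      _ ≤ 1 := by simpa using ih

lemma KN_le_one {μ μ₀ : Zd d → ℝ} (hμ : IsMeasure μ) (hμ₀ : IsMeasure μ₀) (n : ℕ) (z z' : Ed d) :
    KN μ μ₀ n z z' ≤ 1 := (ENNReal.le_tsum z').trans (KN_row hμ hμ₀ n z)

lemma ker_nonneg {μ μ₀ : Zd d → ℝ} (hμ : IsMeasure μ) (hμ₀ : IsMeasure μ₀) (z z' : Ed d) :
    0 ≤ ker μ μ₀ z z' := by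
  unfold ker; split_ifs
  · exact hμ₀.1 _
  · exact hμ.1 _

lemma kerN_eq {μ μ₀ : Zd d → ℝ} (hμ : IsMeasure μ) (hμ₀ : IsMeasure μ₀) (n : ℕ) (z z' : Ed d) :
    kerN μ μ₀ n z z' = (KN μ μ₀ n z z').toReal := by
  induction n generalizing z' with
  | zero => simp only [kerN, KN]; split_ifs <;> simp
  | succ n ih =>
    simp only [kerN, KN]
    rw [ENNReal.tsum_toReal_eq]
    · congr 1; funext w
      rw [ENNReal.toReal_mul, ih, kE, ENNReal.toReal_ofReal (ker_nonneg hμ hμ₀ _ _)]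
    · intro w
      exact ENNReal.mul_ne_top (ne_top_of_le_ne_top ENNReal.one_ne_top (KN_le_one hμ hμ₀ n z w))
        ENNReal.ofReal_ne_top

lemma KN_chapman (μ μ₀ : Zd d → ℝ) (m n : ℕ) (z w z' : Ed d) :
    KN μ μ₀ m z w * KN μ μ₀ n w z' ≤ KN μ μ₀ (m + n) z z' := by
  induction n generalizing z' with
  | zero =>
    simp only [KN, Nat.add_zero]
    split_ifs with h
    · simp [h]
    · simp
  | succ n ih =>
    rw [← Nat.add_assoc]
    simp only [KN]
    rw [← ENNReal.tsum_mul_left]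
    refine ENNReal.tsum_le_tsum fun u => ?_
    rw [← mul_assoc]
    gcongr
    exact ih u

lemma KN_left (μ μ₀ : Zd d → ℝ) (n : ℕ) (z z' : Ed d) :
    KN μ μ₀ (n + 1) z z' = ∑' w, kE μ μ₀ z w * KN μ μ₀ n w z' := by
  induction n generalizing z' with
  | zero =>
    simp only [KN]
    simp
  | succ n ih =>
    rw [KN]
    simp only [ih]
    simp only [KN, ← ENNReal.tsum_mul_left, ← ENNReal.tsum_mul_right]
    rw [ENNReal.tsum_comm]
    simp only [mul_assoc]

/-- Horizontal shift. -/
def sh (w : Fin d → ℤ) : Ed d ≃ Ed d := (Equiv.addRight w).prodCongr (Equiv.refl ℕ)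

lemma sh_apply (w : Fin d → ℤ) (z : Ed d) : sh w z = (z.1 + w, z.2) := rfl

lemma ker_sh (μ μ₀ : Zd d → ℝ) (w : Fin d → ℤ) (z z' : Ed d) :
    ker μ μ₀ (sh w z) (sh w z') = ker μ μ₀ z z' := by
  simp [ker, jump, sh_apply]

lemma KN_sh (μ μ₀ : Zd d → ℝ) (n : ℕ) (w : Fin d → ℤ) (z z' : Ed d) :
    KN μ μ₀ n (sh w z) (sh w z') = KN μ μ₀ n z z' := by
  induction n generalizing z' with
  | zero => simp [KN]
  | succ n ih =>
    simp only [KN]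
    rw [← (sh w).tsum_eq]
    congr 1; funext u
    rw [ih, kE, kE, ker_sh]

/-- Green function in `ℝ≥0∞`. -/
def gE (μ μ₀ : Zd d → ℝ) (c : ENNReal) (z : Ed d) : ENNReal := ∑' n, c ^ n * KN μ μ₀ n z 0

lemma gE_harnack (μ μ₀ : Zd d → ℝ) (c : ENNReal) (k : ℕ) (z z' : Ed d) :
    c ^ k * KN μ μ₀ k z z' * gE μ μ₀ c z' ≤ gE μ μ₀ c z := by
  unfold gE
  rw [← ENNReal.tsum_mul_left]
  calc ∑' n, c ^ k * KN μ μ₀ k z z' * (c ^ n * KN μ μ₀ n z' 0)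
      ≤ ∑' n, c ^ (k + n) * KN μ μ₀ (k + n) z 0 := by
        refine ENNReal.tsum_le_tsum fun n => ?_
        calc _ = c ^ (k + n) * (KN μ μ₀ k z z' * KN μ μ₀ n z' 0) := by rw [pow_add]; ring
          _ ≤ _ := by gcongr; exact KN_chapman _ _ _ _ _ _ _
    _ ≤ _ := ENNReal.tsum_comp_le_tsum_of_injective (add_right_injective k)
        (fun n => c ^ n * KN μ μ₀ n z 0)

lemma gE_super (μ μ₀ : Zd d → ℝ) (c : ENNReal) (z : Ed d) :
    c * ∑' w, kE μ μ₀ z w * gE μ μ₀ c w ≤ gE μ μ₀ c z := by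
  unfold gE
  simp only [← ENNReal.tsum_mul_left]
  rw [ENNReal.tsum_comm]
  calc ∑' n, ∑' w, c * (kE μ μ₀ z w * (c ^ n * KN μ μ₀ n w 0))
      = ∑' n, c ^ (n + 1) * KN μ μ₀ (n + 1) z 0 := by
        congr 1; funext n
        rw [KN_left, ← ENNReal.tsum_mul_left]
        congr 1; funext w
        ring
    _ ≤ _ := ENNReal.tsum_comp_le_tsum_of_injective (add_left_injective 1)
        (fun n => c ^ n * KN μ μ₀ n z 0)

lemma gE_zero_ne_top {μ μ₀ : Zd d → ℝ} (hμ : IsMeasure μ) (hμ₀ : IsMeasure μ₀)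
    {r t : ℝ} (hr : rho μ μ₀ < r) (hr0 : 0 < r) (hrt : r < t) :
    gE μ μ₀ (ENNReal.ofReal t⁻¹) 0 ≠ ⊤ := by
  have ht : 0 < t := hr0.trans hrt
  have hnn : ∀ n, 0 ≤ kerN μ μ₀ n 0 0 := fun n => by
    rw [kerN_eq hμ hμ₀]; exact ENNReal.toReal_nonneg
  have hle : ∀ n, kerN μ μ₀ n 0 0 ≤ 1 := fun n => by
    rw [kerN_eq hμ hμ₀]
    exact ENNReal.toReal_le_of_le_ofReal zero_le_one (by simpa using KN_le_one hμ hμ₀ n 0 0)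
  have hbdd : IsBoundedUnder (· ≤ ·) atTop
      (fun n : ℕ => (kerN μ μ₀ n 0 0) ^ ((n : ℝ)⁻¹)) :=
    isBoundedUnder_of ⟨1, fun n => Real.rpow_le_one (hnn n) (hle n) (by positivity)⟩
  have hev := eventually_lt_of_limsup_lt hr hbdd
  have hs : Summable fun n : ℕ => t⁻¹ ^ n * kerN μ μ₀ n 0 0 := by
    refine Summable.of_norm_bounded_eventually_nat (g := fun n : ℕ => (r / t) ^ n)
      (summable_geometric_of_lt_one (by positivity) ((div_lt_one ht).mpr hrt)) ?_
    filter_upwards [hev, eventually_gt_atTop 0] with n hn hn0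
    have h1 : kerN μ μ₀ n 0 0 ≤ r ^ n := by
      have h2 := pow_le_pow_left₀ (Real.rpow_nonneg (hnn n) _) hn.le n
      rwa [Real.rpow_inv_natCast_pow (hnn n) hn0.ne'] at h2
    rw [Real.norm_of_nonneg (mul_nonneg (by positivity) (hnn n)), div_pow, div_eq_inv_mul, inv_pow]
    gcongr
  have e : gE μ μ₀ (ENNReal.ofReal t⁻¹) 0 = ENNReal.ofReal (∑' n : ℕ, t⁻¹ ^ n * kerN μ μ₀ n 0 0) := by
    rw [ENNReal.ofReal_tsum_of_nonneg (fun n => mul_nonneg (by positivity) (hnn n)) hs, gE]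
    congr 1; funext n
    rw [ENNReal.ofReal_mul (by positivity), ENNReal.ofReal_pow (by positivity), kerN_eq hμ hμ₀,
      ENNReal.ofReal_toReal (ne_top_of_le_ne_top ENNReal.one_ne_top (KN_le_one hμ hμ₀ n 0 0))]
  rw [e]; exact ENNReal.ofReal_ne_top

/-- Existence of a positive superharmonic function with a Harnack property, in log form. -/
lemma exists_super {μ μ₀ : Zd d → ℝ} (hμ : IsMeasure μ) (hμ₀ : IsMeasure μ₀) (h1 : H1 μ μ₀)
    {r t : ℝ} (hr : rho μ μ₀ < r) (hr0 : 0 < r) (hrt : r < t) :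
    ∃ l : Ed d → ℝ, (∀ z z', ∃ C, ∀ w, l (sh w z') - l (sh w z) ≤ C) ∧
      ∀ (z : Ed d) (F : Finset (Ed d)),
        ∑ z' ∈ F, ker μ μ₀ z z' * Real.exp (l z' - l z) ≤ t := by
  have ht : 0 < t := hr0.trans hrt
  set c := ENNReal.ofReal t⁻¹ with hc
  have hc0 : c ≠ 0 := by
    rw [hc, ne_eq, ENNReal.ofReal_eq_zero, not_le]; positivity
  have hctop : c ≠ ⊤ := ENNReal.ofReal_ne_top
  have hirr : ∀ z z' : Ed d, ∃ n, KN μ μ₀ n z z' ≠ 0 := fun z z' => by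
    obtain ⟨n, hn⟩ := h1 z z'
    refine ⟨n, fun e => ?_⟩
    rw [kerN_eq hμ hμ₀, e] at hn
    simp at hn
  set f := gE μ μ₀ c with hf
  have hf0 : f 0 ≠ ⊤ := gE_zero_ne_top hμ hμ₀ hr hr0 hrt
  have hftop : ∀ z, f z ≠ ⊤ := fun z e => by
    obtain ⟨n, hn⟩ := hirr 0 z
    have := gE_harnack μ μ₀ c n 0 z
    rw [← hf, e, ENNReal.mul_top (mul_ne_zero (pow_ne_zero _ hc0) hn), top_le_iff] at this
    exact hf0 this
  have hfpos : ∀ z, f z ≠ 0 := fun z e => by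
    obtain ⟨n, hn⟩ := hirr z 0
    have h2 : c ^ n * KN μ μ₀ n z 0 ≤ f z := ENNReal.le_tsum (f := fun n => c ^ n * KN μ μ₀ n z 0) n
    rw [e, nonpos_iff_eq_zero] at h2
    exact mul_ne_zero (pow_ne_zero _ hc0) hn h2
  have hpos : ∀ z, 0 < (f z).toReal := fun z => ENNReal.toReal_pos (hfpos z) (hftop z)
  refine ⟨fun z => Real.log (f z).toReal, ?_, ?_⟩
  · intro z z'
    obtain ⟨n, hn⟩ := hirr z z'
    set K := (c ^ n * KN μ μ₀ n z z').toReal with hK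
    have hKpos : 0 < K := ENNReal.toReal_pos (mul_ne_zero (pow_ne_zero _ hc0) hn)
      (ENNReal.mul_ne_top (ENNReal.pow_ne_top hctop)
        (ne_top_of_le_ne_top ENNReal.one_ne_top (KN_le_one hμ hμ₀ n z z')))
    refine ⟨-Real.log K, fun w => ?_⟩
    have h2 := gE_harnack μ μ₀ c n (sh w z) (sh w z')
    rw [KN_sh] at h2
    have h3 := ENNReal.toReal_mono (hftop _) h2
    rw [ENNReal.toReal_mul] at h3
    have h4 := Real.log_le_log (mul_pos hKpos (hpos (sh w z'))) h3
    rw [Real.log_mul hKpos.ne' (hpos _).ne'] at h4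
    linarith
  · intro z F
    have h2 : c * ∑ z' ∈ F, kE μ μ₀ z z' * f z' ≤ f z :=
      le_trans (by gcongr; exact ENNReal.sum_le_tsum F) (gE_super μ μ₀ c z)
    have h3 := ENNReal.toReal_mono (hftop z) h2
    have hnt : ∀ w ∈ F, kE μ μ₀ z w * f w ≠ ⊤ := fun w _ =>
      ENNReal.mul_ne_top ENNReal.ofReal_ne_top (hftop w)
    rw [ENNReal.toReal_mul, ENNReal.toReal_sum hnt, hc,
      ENNReal.toReal_ofReal (by positivity)] at h3
    simp only [ENNReal.toReal_mul, kE, ENNReal.toReal_ofReal (ker_nonneg hμ hμ₀ _ _)] at h3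
    have h4 : ∑ z' ∈ F, ker μ μ₀ z z' * (f z').toReal ≤ t * (f z).toReal := by
      rwa [inv_mul_le_iff₀ ht] at h3
    have h5 : ∑ z' ∈ F, ker μ μ₀ z z' * Real.exp (Real.log (f z').toReal - Real.log (f z).toReal)
        = (∑ z' ∈ F, ker μ μ₀ z z' * (f z').toReal) / (f z).toReal := by
      rw [Finset.sum_div]
      refine Finset.sum_congr rfl fun u _ => ?_
      rw [Real.exp_sub, Real.exp_log (hpos _), Real.exp_log (hpos _), mul_div_assoc]
    rw [h5, div_le_iff₀ (hpos z)]
    exact h4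

lemma sh_sh (w v : Fin d → ℤ) (z : Ed d) : sh w (sh v z) = sh (w + v) z := by
  simp only [sh_apply, Prod.mk.injEq, and_true]; abel

/-- Averaging a superharmonic function over horizontal translations makes it exponential
in the horizontal variable. -/
lemma exists_exp_super {μ μ₀ : Zd d → ℝ} (hμ : IsMeasure μ) (hμ₀ : IsMeasure μ₀) {t : ℝ}
    (l : Ed d → ℝ) (hl : ∀ z z', ∃ C, ∀ w, l (sh w z') - l (sh w z) ≤ C)
    (hsup : ∀ (z : Ed d) (F : Finset (Ed d)),
        ∑ z' ∈ F, ker μ μ₀ z z' * Real.exp (l z' - l z) ≤ t) :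
    ∃ (α : Fin d → ℝ) (c : ℕ → ℝ), ∀ (y : ℕ) (F : Finset (Ed d)),
        ∑ z' ∈ F, ker μ μ₀ (0, y) z' *
          Real.exp ((∑ i, α i * (z'.1 i : ℝ)) + (c z'.2 - c y)) ≤ t := by
  obtain ⟨M, hM⟩ := exists_mean d
  have hb : ∀ z z', Bd (fun w => l (sh w z') - l (sh w z)) := by
    intro z z'
    obtain ⟨C, hC⟩ := hl z z'
    obtain ⟨D, hD⟩ := hl z' z
    refine ⟨max C D, fun w => abs_le.mpr ⟨?_, (hC w).trans (le_max_left _ _)⟩⟩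
    have := (hD w).trans (le_max_right C D)
    linarith
  let G : Ed d → ℝ := fun z => M fun w => l (sh w z) - l (sh w 0)
  have hG : ∀ z z', M (fun w => l (sh w z') - l (sh w z)) = G z' - G z := by
    intro z z'
    change _ = M _ - M _
    rw [← hM.sub (hb 0 z') (hb 0 z)]
    congr 1; funext w; ring
  -- Jensen
  have hJ : ∀ (z : Ed d) (F : Finset (Ed d)),
      ∑ z' ∈ F, ker μ μ₀ z z' * Real.exp (G z' - G z) ≤ t := by
    intro z F
    set p : Ed d → ℝ := fun z' => ker μ μ₀ z z' * Real.exp (G z' - G z) with hp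
    have hpn : ∀ z', 0 ≤ p z' := fun z' => mul_nonneg (ker_nonneg hμ hμ₀ _ _) (Real.exp_pos _).le
    obtain ⟨hs1, hs2⟩ := hM.sum F p (fun z' w => l (sh w z') - l (sh w z)) (hb z)
    have hle := hM.le _ (t - ∑ z' ∈ F, p z' * (1 - (G z' - G z))) hs1 (by
      intro w
      rw [le_sub_iff_add_le, ← Finset.sum_add_distrib]
      have h2 := hsup (sh w z) (F.map (sh w).toEmbedding)
      rw [Finset.sum_map] at h2
      refine le_trans (Finset.sum_le_sum fun z' _ => ?_) h2
      simp only [Equiv.coe_toEmbedding, ker_sh]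
      have h3 := Real.add_one_le_exp ((l (sh w z') - l (sh w z)) - (G z' - G z))
      have h4 : Real.exp (l (sh w z') - l (sh w z)) = Real.exp (G z' - G z) *
          Real.exp ((l (sh w z') - l (sh w z)) - (G z' - G z)) := by
        rw [← Real.exp_add]; ring_nf
      rw [h4, ← mul_assoc]
      have h5 := mul_le_mul_of_nonneg_left h3 (hpn z')
      simp only [hp] at h5 ⊢
      linarith)
    rw [hs2] at hle
    have e : ∑ z' ∈ F, p z' * M (fun w => l (sh w z') - l (sh w z))
        + ∑ z' ∈ F, p z' * (1 - (G z' - G z)) = ∑ z' ∈ F, p z' := by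
      rw [← Finset.sum_add_distrib]
      refine Finset.sum_congr rfl fun z' _ => ?_
      rw [hG]; ring
    linarith
  -- exponential in the horizontal direction
  have hA : ∀ (v : Fin d → ℤ) (z : Ed d), G (sh v z) - G z = G (sh v 0) - G 0 := by
    intro v z
    have h1 := hM.inv v _ (hb 0 z)
    have h2 : (fun w => l (sh (w + v) z) - l (sh (w + v) 0))
        = fun w => l (sh w (sh v z)) - l (sh w (sh v 0)) := by
      funext w; rw [sh_sh, sh_sh]
    rw [h2, hG, hG] at h1
    linarith
  let A : (Fin d → ℤ) →+ ℝ := AddMonoidHom.mk' (fun v => G (sh v 0) - G 0) (by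
    intro v v'
    have := hA v (sh v' 0)
    rw [sh_sh] at this
    linarith)
  have hAsum : ∀ v : Fin d → ℤ, A v = ∑ i, A (Pi.single i 1) * (v i : ℝ) := by
    intro v
    have hv : v = ∑ i, v i • (Pi.single i 1 : Fin d → ℤ) := by
      funext j
      simp [Finset.sum_apply, Pi.single_apply]
    conv_lhs => rw [hv]
    rw [map_sum]
    refine Finset.sum_congr rfl fun i _ => ?_
    rw [map_zsmul, zsmul_eq_mul, mul_comm]
  refine ⟨fun i => A (Pi.single i 1), fun y => G (0, y), fun y F => ?_⟩
  refine le_trans (le_of_eq (Finset.sum_congr rfl fun z' _ => ?_)) (hJ (0, y) F)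
  congr 2
  rw [← hAsum]
  have h1 := hA z'.1 (0, z'.2)
  have h2 : sh z'.1 ((0, z'.2) : Ed d) = z' := by simp [sh_apply]
  rw [h2] at h1
  change (G (sh z'.1 0) - G 0) + _ = _
  linarith

lemma step_ineq {μ μ₀ : Zd d → ℝ} {t : ℝ} (α : Fin d → ℝ) (c : ℕ → ℝ)
    (h : ∀ (y : ℕ) (F : Finset (Ed d)),
        ∑ z' ∈ F, ker μ μ₀ (0, y) z' *
          Real.exp ((∑ i, α i * (z'.1 i : ℝ)) + (c z'.2 - c y)) ≤ t)
    (y : ℕ) (F : Finset (Zd d)) (hF : ∀ z ∈ F, 0 ≤ (y : ℤ) + z.2) :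
    ∑ z ∈ F, (if y = 0 then μ₀ z else μ z) *
      Real.exp ((∑ i, α i * (z.1 i : ℝ)) + (c ((y : ℤ) + z.2).toNat - c y)) ≤ t := by
  let e : Zd d → Ed d := fun z => (z.1, ((y : ℤ) + z.2).toNat)
  have hinj : Set.InjOn e F := by
    intro u hu v hv huv
    have h1 := hF u hu
    have h2 := hF v hv
    simp only [e, Prod.mk.injEq] at huv
    refine Prod.ext huv.1 ?_
    omega
  have h1 := h y (F.image e)
  rw [Finset.sum_image hinj] at h1
  refine le_trans (le_of_eq (Finset.sum_congr rfl fun z hz => ?_)) h1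
  have hj : jump ((0, y) : Ed d) (e z) = z := by
    refine Prod.ext ?_ ?_
    · simp [jump, e]
    · simp only [jump, e]
      rw [Int.toNat_of_nonneg (hF z hz)]; ring
  simp only [ker, hj, e]

lemma exists_beta {μ μ₀ : Zd d → ℝ} (hμ : IsMeasure μ) (hμ₀ : IsMeasure μ₀) (h0 : H0 μ μ₀)
    (hdown : ∃ x, 0 < μ (x, -1)) {t : ℝ} (ht : 0 < t) (α : Fin d → ℝ) (c : ℕ → ℝ)
    (h : ∀ (y : ℕ) (F : Finset (Ed d)),
        ∑ z' ∈ F, ker μ μ₀ (0, y) z' *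
          Real.exp ((∑ i, α i * (z'.1 i : ℝ)) + (c z'.2 - c y)) ≤ t)
    (ε : ℝ) (hε : 0 < ε) :
    ∃ β : ℝ, phi μ (α, β) ≤ Real.exp ε * t ∧ phi μ₀ (α, β) ≤ t := by
  have hstep := step_ineq α c h
  obtain ⟨x, hx⟩ := hdown
  let δ : ℕ → ℝ := fun y => c (y + 1) - c y
  have hbdd : BddBelow (Set.range δ) := by
    refine ⟨Real.log (μ (x, -1)) + (∑ i, α i * (x i : ℝ)) - Real.log t, ?_⟩
    rintro _ ⟨y, rfl⟩
    have h1 := hstep (y + 1) {(x, -1)} (by intro z hz; simp at hz; subst hz; simp)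
    simp only [Finset.sum_singleton, Nat.add_eq_zero_iff, one_ne_zero, and_false, if_false] at h1
    have h2 : (((y + 1 : ℕ) : ℤ) + (-1)).toNat = y := by omega
    rw [h2] at h1
    have h3 := Real.log_le_log (by positivity) h1
    rw [Real.log_mul hx.ne' (Real.exp_pos _).ne', Real.log_exp] at h3
    simp only [δ]
    linarith
  set β := sInf (Set.range δ) with hβ
  have hδ : ∀ y, β ≤ δ y := fun y => csInf_le hbdd ⟨y, rfl⟩
  have hup : ∀ y k : ℕ, β * k ≤ c (y + k) - c y := by
    intro y k
    induction k with
    | zero => simp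
    | succ k ih =>
      have := hδ (y + k)
      simp only [δ] at this
      push_cast
      rw [← Nat.add_assoc]
      linarith
  have hup' : ∀ (y : ℕ) (k : ℤ), 0 ≤ k → β * k ≤ c ((y : ℤ) + k).toNat - c y := by
    intro y k hk
    lift k to ℕ using hk
    have : ((y : ℤ) + k).toNat = y + k := by omega
    rw [this]
    exact_mod_cast hup y k
  refine ⟨β, ?_, ?_⟩
  · refine Real.tsum_le_of_sum_le (fun z => mul_nonneg (hμ.1 z) (Real.exp_pos _).le) fun F => ?_
    obtain ⟨_, ⟨y, rfl⟩, hy⟩ := exists_lt_of_csInf_lt (Set.range_nonempty δ)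
      (show sInf (Set.range δ) < β + ε by linarith)
    have h1 := hstep (y + 1) (F.filter fun z => -1 ≤ z.2) (by
      intro z hz
      have := (Finset.mem_filter.mp hz).2
      push_cast
      omega)
    rw [← Finset.sum_filter_of_ne (p := fun z : Zd d => -1 ≤ z.2) (by
      intro z _ hne
      by_contra hlt
      exact hne (by rw [h0.1 z (not_le.mp hlt), zero_mul]))]
    refine le_trans ?_ (mul_le_mul_of_nonneg_left h1 (Real.exp_pos ε).le)
    rw [Finset.mul_sum]
    refine Finset.sum_le_sum fun z hz => ?_
    have hz2 := (Finset.mem_filter.mp hz).2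
    simp only [Nat.add_eq_zero_iff, one_ne_zero, and_false, if_false]
    rw [mul_left_comm, ← Real.exp_add]
    refine mul_le_mul_of_nonneg_left (Real.exp_le_exp.mpr ?_) (hμ.1 z)
    simp only [dotZ]
    rcases lt_or_ge z.2 0 with hneg | hnn
    · have hz' : z.2 = -1 := by omega
      have h2 : (((y + 1 : ℕ) : ℤ) + z.2).toNat = y := by omega
      rw [h2, hz']
      simp only [δ] at hy
      push_cast
      linarith
    · have := hup' (y + 1) z.2 hnn
      linarith
  · refine Real.tsum_le_of_sum_le (fun z => mul_nonneg (hμ₀.1 z) (Real.exp_pos _).le) fun F => ?_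
    have h1 := hstep 0 (F.filter fun z => 0 ≤ z.2) (by
      intro z hz
      have := (Finset.mem_filter.mp hz).2
      simpa using this)
    rw [← Finset.sum_filter_of_ne (p := fun z : Zd d => 0 ≤ z.2) (by
      intro z _ hne
      by_contra hlt
      exact hne (by rw [h0.2 z (not_le.mp hlt), zero_mul]))]
    refine le_trans (Finset.sum_le_sum fun z hz => ?_) h1
    have hz2 := (Finset.mem_filter.mp hz).2
    simp only [if_true]
    refine mul_le_mul_of_nonneg_left (Real.exp_le_exp.mpr ?_) (hμ₀.1 z)
    have := hup' 0 z.2 hz2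
    simp only [dotZ]
    linarith

/-- Irreducibility forces downward jumps. -/
lemma exists_down {μ μ₀ : Zd d → ℝ} (hμ : IsMeasure μ) (h0 : H0 μ μ₀) (h1 : H1 μ μ₀) :
    ∃ x, 0 < μ (x, -1) := by
  by_contra hcon
  push Not at hcon
  have hz : ∀ z : Zd d, z.2 < 0 → μ z = 0 := by
    intro z hz
    rcases lt_or_ge z.2 (-1) with h | h
    · exact h0.1 z h
    · have : z = (z.1, -1) := Prod.ext rfl (by simp only; omega)
      rw [this]
      exact le_antisymm (hcon _) (hμ.1 _)
  have hmono : ∀ n (z z' : Ed d), kerN μ μ₀ n z z' ≠ 0 → z.2 ≤ z'.2 := by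
    intro n
    induction n with
    | zero =>
      intro z z' h
      simp only [kerN, ne_eq, ite_eq_right_iff, one_ne_zero, imp_false, not_not] at h
      rw [h]
    | succ n ih =>
      intro z z' h
      simp only [kerN] at h
      obtain ⟨w, hw⟩ : ∃ w, kerN μ μ₀ n z w * ker μ μ₀ w z' ≠ 0 := by
        by_contra hall
        push Not at hall
        exact h (by simp [hall])
      have h2 := ih z w (left_ne_zero_of_mul hw)
      refine h2.trans ?_
      by_contra hlt
      push Not at hlt
      have hj : (jump w z').2 < 0 := by simp only [jump]; omega
      apply right_ne_zero_of_mul hw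
      simp only [ker]
      split_ifs
      · exact h0.2 _ hj
      · exact hz _ hj
  obtain ⟨n, hn⟩ := h1 (0, 1) (0, 0)
  have := hmono n _ _ hn.ne'
  simp at this

lemma exists_slater {μ μ₀ : Zd d → ℝ} (hμ : IsMeasure μ) (hμ₀ : IsMeasure μ₀) (h0 : H0 μ μ₀)
    (h1 : H1 μ μ₀) {t : ℝ} (ht0 : 0 < t) (ht : rho μ μ₀ < t) :
    ∃ s : Rd d, phi μ s < t ∧ phi μ₀ s < t := by
  obtain ⟨r, hr1, hrt⟩ := exists_between (max_lt ht ht0)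
  obtain ⟨t₁, hrt₁, ht₁⟩ := exists_between hrt
  obtain ⟨t₂, h12, ht₂⟩ := exists_between ht₁
  have hr0 : 0 < r := (le_max_right _ _).trans_lt hr1
  have hrr : rho μ μ₀ < r := (le_max_left _ _).trans_lt hr1
  have ht₁0 : 0 < t₁ := hr0.trans hrt₁
  obtain ⟨l, hl, hsup⟩ := exists_super hμ hμ₀ h1 hrr hr0 hrt₁
  obtain ⟨α, c, hc⟩ := exists_exp_super hμ hμ₀ l hl hsup
  obtain ⟨β, hβ, hβ₀⟩ := exists_beta hμ hμ₀ h0 (exists_down hμ h0 h1) ht₁0 α c hc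
    (Real.log (t₂ / t₁)) (Real.log_pos ((one_lt_div ht₁0).mpr h12))
  rw [Real.exp_log (div_pos (ht₁0.trans h12) ht₁0), div_mul_cancel₀ _ ht₁0.ne'] at hβ
  exact ⟨(α, β), hβ.trans_lt ht₂, hβ₀.trans_lt ht₁⟩

/-- Lemma 2, second case: under (H0)-(H3), for `t > ρ(P)` and
`a ∈ Γ₊^t` with `φ₀(ā^t) = t` and `a ∉ ∂₀D^t`, the normal cone to `Ĥ^t` at `a` is
generated by `∇φ(a)` and `∇φ₀(ā^t) + κ_a ∇φ(ā^t)` with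
`κ_a = −(∂φ₀/∂β)(ā^t)/(∂φ/∂β)(ā^t)`. -/
theorem normal_cone_two_rays {d : ℕ} (μ μ₀ : Zd d → ℝ)
    (hμ : IsMeasure μ) (hμ₀ : IsMeasure μ₀)
    (h0 : H0 μ μ₀) (h1 : H1 μ μ₀) (h2 : H2 μ) (h3 : H3 μ) (h3' : H3 μ₀)
    (t : ℝ) (ht : rho μ μ₀ < t)
    (a : Rd d) (ha : a ∈ GammaPlus μ μ₀ t)
    (hcase : phi μ₀ (abar μ t a) = t ∧ a ∉ dZero μ t) :
    Vcone μ μ₀ t a =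
      {v : Rd d | ∃ c₁ c₂ : ℝ, 0 ≤ c₁ ∧ 0 ≤ c₂ ∧
        v = c₁ • gradV (phi μ) a +
            c₂ • (gradV (phi μ₀) (abar μ t a) +
              (-(dBeta (phi μ₀) (abar μ t a) / dBeta (phi μ) (abar μ t a))) •
                gradV (phi μ) (abar μ t a))} := by
  have hdown := exists_down hμ h0 h1
  have ht0 : 0 < t := by
    obtain ⟨x, hx⟩ := hdown
    refine lt_of_lt_of_le (mul_pos hx (Real.exp_pos (dotZ a (x, -1)))) (le_trans ?_ ha.1.2)
    exact (h3 a).le_tsum (x, -1) fun z _ => mul_nonneg (hμ.1 z) (Real.exp_pos _).le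
  obtain ⟨s, hs, hs₀⟩ := exists_slater hμ hμ₀ h0 h1 ht0 ht
  exact cone_of_slater μ μ₀ hμ.1 hμ₀.1 h0.2 h3 h3' hdown t s hs hs₀ a ha hcase

end RWHalfspace
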